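/- arXiv:2303.14022 — 9 statements merged into one kernel-verified Lean document; each statement's English description precedes it below -/
import Mathlib

section
/- Soundness of the labelled natural deduction system for LT: if Γ ⊢ b:ψ then Γ ⊨ b:ψ. -/
/-- LT formulas: term algebra over variables with external connectives
`⊥, ¬, ∨, ∧` and internal connectives `i⊥, i¬, i∨, i∧`. -/
inductive Fm where
  | var  : ℕ → Fm
  | ebot : Fm
  | enot : Fm → Fm
  | eor  : Fm → Fm → Fm
  | eand : Fm → Fm → Fm
  | ibot : Fm
  | inot : Fm → Fm
  | ior  : Fm → Fm → Fm
  | iand : Fm → Fm → Fm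

/-- `H : Fm → Set B` is a homomorphism into the powerset algebra `𝒫 B`. -/
structure IsHom {B : Type} [BooleanAlgebra B] (H : Fm → Set B) : Prop where
  ebot : H .ebot = ∅
  enot : ∀ φ, H (.enot φ) = (H φ)ᶜ
  eor  : ∀ φ ψ, H (.eor φ ψ) = H φ ∪ H ψ
  eand : ∀ φ ψ, H (.eand φ ψ) = H φ ∩ H ψ
  ibot : H .ibot = {(⊥ : B)}
  inot : ∀ φ, H (.inot φ) = (fun a => aᶜ) '' H φ
  ior  : ∀ φ ψ, H (.ior φ ψ) = Set.image2 (· ⊔ ·) (H φ) (H ψ)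
  iand : ∀ φ ψ, H (.iand φ ψ) = Set.image2 (· ⊓ ·) (H φ) (H ψ)

/-- Entailment in LT. -/
def Entails (Δ : Set Fm) (ψ : Fm) : Prop :=
  ∀ (B : Type) [BooleanAlgebra B] (H : Fm → Set B),
    IsHom H → (⋂ φ ∈ Δ, H φ) ⊆ H ψ

/-- Labels: classical propositional formulas. -/
inductive Lb where
  | var : ℕ → Lb
  | bot : Lb
  | not : Lb → Lb
  | or  : Lb → Lb → Lb
  | and : Lb → Lb → Lb

/-- `h : Lb → B` is a label homomorphism (Boolean evaluation). -/
structure IsLbHom {B : Type} [BooleanAlgebra B] (h : Lb → B) : Prop where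
  bot : h .bot = ⊥
  not : ∀ a, h (.not a) = (h a)ᶜ
  or  : ∀ a b, h (.or a b) = h a ⊔ h b
  and : ∀ a b, h (.and a b) = h a ⊓ h b

/-- Atomic labels occurring in a label. -/
def Lb.atoms : Lb → Set ℕ
  | var i => {i}
  | bot => ∅
  | not a => a.atoms
  | or a b => a.atoms ∪ b.atoms
  | and a b => a.atoms ∪ b.atoms

/-- Two-valued (classical) evaluation of labels, for the tautology side condition. -/
def Lb.evalBool (v : ℕ → Bool) : Lb → Bool
  | var i => v i
  | bot => false
  | not a => !(a.evalBool v)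
  | or a b => a.evalBool v || b.evalBool v
  | and a b => a.evalBool v && b.evalBool v

/-- The internal top `i⊤ = i¬ i⊥`. -/
def Fm.itop : Fm := .inot .ibot

/-- The labelled formula `a = b`, i.e. `(a∨¬b)∧(¬a∨b) : i⊤`. -/
def lbEq (a b : Lb) : Lb × Fm :=
  (Lb.and (Lb.or a (Lb.not b)) (Lb.or (Lb.not a) b), Fm.itop)

/-- The labelled natural deduction system for LT. -/
inductive Proves : Set (Lb × Fm) → Lb × Fm → Prop where
  | hyp {Γ c} : c ∈ Γ → Proves Γ c
  | eandI {Γ a φ ψ} : Proves Γ (a, φ) → Proves Γ (a, ψ) →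
      Proves Γ (a, Fm.eand φ ψ)
  | eandE1 {Γ a φ ψ} : Proves Γ (a, Fm.eand φ ψ) → Proves Γ (a, φ)
  | eandE2 {Γ a φ ψ} : Proves Γ (a, Fm.eand φ ψ) → Proves Γ (a, ψ)
  | eorI1 {Γ a φ ψ} : Proves Γ (a, φ) → Proves Γ (a, Fm.eor φ ψ)
  | eorI2 {Γ a φ ψ} : Proves Γ (a, ψ) → Proves Γ (a, Fm.eor φ ψ)
  | eorE {Γ a b φ ψ σ} : Proves Γ (a, Fm.eor φ ψ) →
      Proves (insert (a, φ) Γ) (b, σ) → Proves (insert (a, ψ) Γ) (b, σ) →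
      Proves Γ (b, σ)
  | enotI {Γ a b φ} : Proves (insert (a, φ) Γ) (b, Fm.ebot) →
      Proves Γ (a, Fm.enot φ)
  | enotE {Γ a φ} : Proves Γ (a, φ) → Proves Γ (a, Fm.enot φ) →
      Proves Γ (a, Fm.ebot)
  | raa {Γ a b φ} : Proves (insert (a, Fm.enot φ) Γ) (b, Fm.ebot) →
      Proves Γ (a, φ)
  | botE {Γ a b φ} : Proves Γ (a, Fm.ebot) → Proves Γ (b, φ)
  | iandI {Γ a b φ ψ} : Proves Γ (a, φ) → Proves Γ (b, ψ) →
      Proves Γ (Lb.and a b, Fm.iand φ ψ)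
  | iandE {Γ} {a b : Lb} {p q : ℕ} {φ ψ σ : Fm} :
      p ≠ q →
      (∀ r ∈ Γ, p ∉ (Prod.fst r).atoms ∧ q ∉ (Prod.fst r).atoms) →
      p ∉ a.atoms → q ∉ a.atoms → p ∉ b.atoms → q ∉ b.atoms →
      Proves Γ (a, Fm.iand φ ψ) →
      Proves (insert (Lb.var p, φ) (insert (Lb.var q, ψ)
        (insert (lbEq a (Lb.and (Lb.var p) (Lb.var q))) Γ))) (b, σ) →
      Proves Γ (b, σ)
  | iorI {Γ a b φ ψ} : Proves Γ (a, φ) → Proves Γ (b, ψ) →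
      Proves Γ (Lb.or a b, Fm.ior φ ψ)
  | iorE {Γ} {a b : Lb} {p q : ℕ} {φ ψ σ : Fm} :
      p ≠ q →
      (∀ r ∈ Γ, p ∉ (Prod.fst r).atoms ∧ q ∉ (Prod.fst r).atoms) →
      p ∉ a.atoms → q ∉ a.atoms → p ∉ b.atoms → q ∉ b.atoms →
      Proves Γ (a, Fm.ior φ ψ) →
      Proves (insert (Lb.var p, φ) (insert (Lb.var q, ψ)
        (insert (lbEq a (Lb.or (Lb.var p) (Lb.var q))) Γ))) (b, σ) →
      Proves Γ (b, σ)
  | inotI {Γ a φ} : Proves Γ (a, φ) → Proves Γ (Lb.not a, Fm.inot φ)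
  | inotE {Γ a φ} : Proves Γ (a, Fm.inot φ) → Proves Γ (Lb.not a, φ)
  | taut {Γ b} (L : List Lb) :
      (∀ a ∈ L, Proves Γ (a, Fm.itop)) →
      (∀ v : ℕ → Bool, (∀ a ∈ L, a.evalBool v = true) → b.evalBool v = true) →
      Proves Γ (b, Fm.itop)
  | sub {Γ a b φ} : Proves Γ (lbEq a b) → Proves Γ (b, φ) → Proves Γ (a, φ)

/-- Semantic entailment for labelled formulas. -/
def LEntails (Γ : Set (Lb × Fm)) (c : Lb × Fm) : Prop :=
  ∀ (B : Type) [BooleanAlgebra B] (h : Lb → B) (H : Fm → Set B),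
    IsLbHom h → IsHom H →
    (∀ r ∈ Γ, h r.1 ∈ H r.2) → h c.1 ∈ H c.2

/-- Consistency of a set of labelled formulas. -/
def Consistent (Γ : Set (Lb × Fm)) : Prop := ¬ Proves Γ (Lb.bot, Fm.ebot)

/-- Strict negation on subsets of a Boolean algebra. -/
def sNeg {B : Type} [BooleanAlgebra B] (A : Set B) : Set B :=
  {b | ∀ a ∈ A, b ⊓ a = ⊥}

/-- Strict negation as a defined LT connective:
`∼φ = ¬(((φ i∧ ¬⊥) ∧ ¬ i⊥) i∨ ¬⊥)`. -/
def Fm.snot (φ : Fm) : Fm :=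
  .enot (.ior (.eand (.iand φ (.enot .ebot)) (.enot .ibot)) (.enot .ebot))

/-- The possibility operator `◇φ := (φ i∧ ¬⊥) i∨ ¬⊥`. -/
def Fm.diam (φ : Fm) : Fm := .ior (.iand φ (.enot .ebot)) (.enot .ebot)

/-- The necessity operator `□φ := ¬◇¬φ`. -/
def Fm.box (φ : Fm) : Fm := .enot (Fm.diam (.enot φ))

/-- The evaluation homomorphism determined by a variable assignment. -/
def Fm.eval {B : Type} [BooleanAlgebra B] (v : ℕ → Set B) : Fm → Set B
  | .var i => v i
  | .ebot => ∅
  | .enot φ => (φ.eval v)ᶜ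
  | .eor φ ψ => φ.eval v ∪ ψ.eval v
  | .eand φ ψ => φ.eval v ∩ ψ.eval v
  | .ibot => {⊥}
  | .inot φ => (fun a => aᶜ) '' φ.eval v
  | .ior φ ψ => Set.image2 (· ⊔ ·) (φ.eval v) (ψ.eval v)
  | .iand φ ψ => Set.image2 (· ⊓ ·) (φ.eval v) (ψ.eval v)

/-- A homomorphism has principal variables if every variable is sent to a
(non-empty) principal ideal. -/
def PrincipalVars {B : Type} [BooleanAlgebra B] (H : Fm → Set B) : Prop :=
  ∀ i, ∃ b : B, H (.var i) = {a | a ≤ b}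

/-- PT⁺ formulas. -/
inductive PTFm where
  | var     : ℕ → PTFm
  | snotVar : ℕ → PTFm
  | ibot    : PTFm
  | nb      : PTFm
  | ior     : PTFm → PTFm → PTFm
  | eand    : PTFm → PTFm → PTFm
  | eor     : PTFm → PTFm → PTFm

/-- PT⁺ formulas as LT formulas. -/
def PTFm.toFm : PTFm → Fm
  | .var i => .var i
  | .snotVar i => Fm.snot (.var i)
  | .ibot => .ibot
  | .nb => .enot .ibot
  | .ior φ ψ => .ior φ.toFm ψ.toFm
  | .eand φ ψ => .eand φ.toFm ψ.toFm
  | .eor φ ψ => .eor φ.toFm ψ.toFm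

/-- Valuational team-semantic denotations of PT⁺ formulas. -/
def PTFm.den : PTFm → Set (Set (ℕ → Bool))
  | .var i => {X | ∀ s ∈ X, s i = true}
  | .snotVar i => {X | ∀ s ∈ X, s i = false}
  | .ibot => {∅}
  | .nb => {X | X ≠ ∅}
  | .ior φ ψ => Set.image2 (· ∪ ·) φ.den ψ.den
  | .eand φ ψ => φ.den ∩ ψ.den
  | .eor φ ψ => φ.den ∪ ψ.den

/-- PT⁺ entailment. -/
def PTEntails (Δ : Set PTFm) (φ : PTFm) : Prop :=
  (⋂ δ ∈ Δ, PTFm.den δ) ⊆ PTFm.den φ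

/-- The valuation homomorphism `H_V : Fm → 𝒫(𝒫(2^ℕ))`. -/
def HV : Fm → Set (Set (ℕ → Bool)) :=
  Fm.eval (fun i => {X : Set (ℕ → Bool) | ∀ s ∈ X, s i = true})

/-- The principal variable axioms. -/
def PVA : Set Fm :=
  Set.range (fun i => Fm.box (Fm.ior (Fm.var i) (Fm.snot (Fm.var i))))

/-- A substitution: an algebra endomorphism of the term algebra of formulas. -/
structure IsSubst (σ : Fm → Fm) : Prop where
  ebot : σ .ebot = .ebot
  enot : ∀ φ, σ (.enot φ) = .enot (σ φ)
  eor  : ∀ φ ψ, σ (.eor φ ψ) = .eor (σ φ) (σ ψ)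
  eand : ∀ φ ψ, σ (.eand φ ψ) = .eand (σ φ) (σ ψ)
  ibot : σ .ibot = .ibot
  inot : ∀ φ, σ (.inot φ) = .inot (σ φ)
  ior  : ∀ φ ψ, σ (.ior φ ψ) = .ior (σ φ) (σ ψ)
  iand : ∀ φ ψ, σ (.iand φ ψ) = .iand (σ φ) (σ ψ)

/-- A bundled homomorphism into the powerset of a Boolean algebra. -/
structure LTHom where
  carrier : Type
  inst : BooleanAlgebra carrier
  H : Fm → Set carrier
  isHom : @IsHom carrier inst H

/-- Local entailment of a single homomorphism. -/
def LTHom.localEntails (h : LTHom) (Δ : Set Fm) (φ : Fm) : Prop :=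
  (⋂ δ ∈ Δ, h.H δ) ⊆ h.H φ

/-- Entailment relative to a class of homomorphisms. -/
def ClassEntails (C : Set LTHom) (Δ : Set Fm) (φ : Fm) : Prop :=
  ∀ h ∈ C, h.localEntails Δ φ

/-- The class `C` of homomorphisms is definable by the set `Ax` of formulas. -/
def DefinableBy (C : Set LTHom) (Ax : Set Fm) : Prop :=
  ∀ h : LTHom, h ∈ C ↔ ∀ π ∈ Ax, h.H π = Set.univ

namespace Lb

/-- The label homomorphism extending an assignment of atomic labels. -/
def eval {B : Type} [BooleanAlgebra B] (v : ℕ → B) : Lb → B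
  | var i => v i
  | bot => ⊥
  | not a => (a.eval v)ᶜ
  | or a b => a.eval v ⊔ b.eval v
  | and a b => a.eval v ⊓ b.eval v

theorem isLbHom_eval {B : Type} [BooleanAlgebra B] (v : ℕ → B) : IsLbHom (eval v) :=
  ⟨rfl, fun _ => rfl, fun _ _ => rfl, fun _ _ => rfl⟩

end Lb

namespace IsLbHom

variable {B : Type} [BooleanAlgebra B] {h k : Lb → B}

theorem eq_of_forall_atoms (hh : IsLbHom h) (hk : IsLbHom k) (a : Lb)
    (hv : ∀ i ∈ a.atoms, h (.var i) = k (.var i)) : h a = k a := by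
  induction a with
  | var i => exact hv i rfl
  | bot => rw [hh.bot, hk.bot]
  | not a ih => rw [hh.not, hk.not, ih hv]
  | or a b iha ihb =>
    rw [hh.or, hk.or, iha fun i hi => hv i (Or.inl hi), ihb fun i hi => hv i (Or.inr hi)]
  | and a b iha ihb =>
    rw [hh.and, hk.and, iha fun i hi => hv i (Or.inl hi), ihb fun i hi => hv i (Or.inr hi)]

/-- The values of two atomic labels can be changed without affecting labels in which they do
not occur. -/
theorem exists_update (hh : IsLbHom h) {p q : ℕ} (hpq : p ≠ q) (x y : B) :
    ∃ k : Lb → B, IsLbHom k ∧ k (.var p) = x ∧ k (.var q) = y ∧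
      ∀ a : Lb, p ∉ a.atoms → q ∉ a.atoms → k a = h a := by
  refine ⟨Lb.eval fun i => if i = p then x else if i = q then y else h (.var i),
    Lb.isLbHom_eval _, by simp [Lb.eval], by simp [Lb.eval, hpq.symm], fun a hp hq => ?_⟩
  refine (Lb.isLbHom_eval _).eq_of_forall_atoms hh a fun i hi => ?_
  have hip : i ≠ p := fun e => hp (e ▸ hi)
  have hiq : i ≠ q := fun e => hq (e ▸ hi)
  simp [Lb.eval, hip, hiq]

theorem evalBool_eq_true_iff_notMem (hh : IsLbHom h) {J : Order.Ideal B} (hJ : J.IsPrime)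
    {v : ℕ → Bool} (hv : ∀ i, v i = true ↔ h (.var i) ∉ J) (a : Lb) :
    a.evalBool v = true ↔ h a ∉ J := by
  induction a with
  | var i => exact hv i
  | bot => simp [Lb.evalBool, hh.bot]
  | not a ih =>
    have hor : h a ∈ J ∨ (h a)ᶜ ∈ J := hJ.mem_or_compl_mem
    have hnot : ¬ (h a ∈ J ∧ (h a)ᶜ ∈ J) := fun hm =>
      hJ.toIsProper.notMem_of_compl_mem hm.2 hm.1
    rw [Lb.evalBool, hh.not, Bool.not_eq_true', ← Bool.not_eq_true, ih]
    tauto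
  | or a b iha ihb =>
    rw [Lb.evalBool, hh.or, Bool.or_eq_true, iha, ihb, Order.Ideal.sup_mem_iff]
    tauto
  | and a b iha ihb =>
    have hand : h a ⊓ h b ∈ J ↔ h a ∈ J ∨ h b ∈ J :=
      ⟨hJ.mem_or_mem, fun hm => hm.elim (J.lower inf_le_left) (J.lower inf_le_right)⟩
    rw [Lb.evalBool, hh.and, Bool.and_eq_true, iha, ihb, hand]
    tauto

/-- Two-valued consequence preserves the value `⊤` in every Boolean algebra. -/
theorem eq_top_of_evalBool (hh : IsLbHom h) {S : Set Lb} {b : Lb} (hS : ∀ a ∈ S, h a = ⊤)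
    (hb : ∀ v : ℕ → Bool, (∀ a ∈ S, a.evalBool v = true) → b.evalBool v = true) :
    h b = ⊤ := by
  classical
  by_contra hne
  have hdisj : Disjoint ((Order.PFilter.principal (⊤ : B) : Order.PFilter B) : Set B)
      (Order.Ideal.principal (h b) : Set B) := by
    rw [Set.disjoint_left]
    intro x hx hx'
    have h1 : ⊤ ≤ x := hx
    have h2 : x ≤ h b := hx'
    exact hne (top_le_iff.mp (h1.trans h2))
  obtain ⟨J, hJ, hle, -⟩ := DistribLattice.prime_ideal_of_disjoint_filter_ideal hdisj
  have key := hh.evalBool_eq_true_iff_notMem hJ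
    (v := fun i => decide (h (.var i) ∉ J)) fun i => decide_eq_true_iff
  refine (key b).mp (hb _ fun a ha => (key a).mpr ?_) (hle le_rfl)
  rw [hS a ha]
  exact hJ.toIsProper.top_notMem

end IsLbHom

theorem IsHom.itop {B : Type} [BooleanAlgebra B] {H : Fm → Set B} (hH : IsHom H) :
    H .itop = {⊤} := by
  simp [Fm.itop, hH.inot, hH.ibot]

theorem mem_lbEq_iff {B : Type} [BooleanAlgebra B] {h : Lb → B} {H : Fm → Set B}
    (hh : IsLbHom h) (hH : IsHom H) (a b : Lb) :
    h (lbEq a b).1 ∈ H (lbEq a b).2 ↔ h a = h b := by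
  simp only [lbEq, hH.itop, hh.and, hh.or, hh.not, Set.mem_singleton_iff, inf_eq_top_iff]
  rw [← himp_eq, sup_comm, ← himp_eq, himp_eq_top_iff, himp_eq_top_iff, and_comm,
    le_antisymm_iff]

/-- Soundness of the labelled natural deduction system for LT. -/
theorem LT_soundness (Γ : Set (Lb × Fm)) (c : Lb × Fm)
    (h : Proves Γ c) : LEntails Γ c := by
  induction h with
  | hyp hc => exact fun B _ h H _ _ hΓ => hΓ _ hc
  | eandI _ _ ih₁ ih₂ =>
    intro B _ h H hh hH hΓ
    rw [hH.eand]
    exact ⟨ih₁ B h H hh hH hΓ, ih₂ B h H hh hH hΓ⟩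
  | eandE1 _ ih =>
    intro B _ h H hh hH hΓ
    have := ih B h H hh hH hΓ
    rw [hH.eand] at this
    exact this.1
  | eandE2 _ ih =>
    intro B _ h H hh hH hΓ
    have := ih B h H hh hH hΓ
    rw [hH.eand] at this
    exact this.2
  | eorI1 _ ih =>
    intro B _ h H hh hH hΓ
    rw [hH.eor]
    exact Or.inl (ih B h H hh hH hΓ)
  | eorI2 _ ih =>
    intro B _ h H hh hH hΓ
    rw [hH.eor]
    exact Or.inr (ih B h H hh hH hΓ)
  | eorE _ _ _ ih ih₁ ih₂ =>
    intro B _ h H hh hH hΓ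
    have := ih B h H hh hH hΓ
    rw [hH.eor] at this
    rcases this with hm | hm
    · exact ih₁ B h H hh hH (Set.forall_mem_insert.mpr ⟨hm, hΓ⟩)
    · exact ih₂ B h H hh hH (Set.forall_mem_insert.mpr ⟨hm, hΓ⟩)
  | enotI _ ih =>
    intro B _ h H hh hH hΓ
    rw [hH.enot]
    intro hm
    have := ih B h H hh hH (Set.forall_mem_insert.mpr ⟨hm, hΓ⟩)
    rw [hH.ebot] at this
    exact this
  | enotE _ _ ih₁ ih₂ =>
    intro B _ h H hh hH hΓ
    have := ih₂ B h H hh hH hΓ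
    rw [hH.enot] at this
    exact absurd (ih₁ B h H hh hH hΓ) this
  | raa _ ih =>
    intro B _ h H hh hH hΓ
    by_contra hm
    have := ih B h H hh hH (Set.forall_mem_insert.mpr ⟨by rwa [hH.enot], hΓ⟩)
    rw [hH.ebot] at this
    exact this
  | botE _ ih =>
    intro B _ h H hh hH hΓ
    have := ih B h H hh hH hΓ
    rw [hH.ebot] at this
    exact this.elim
  | iandI _ _ ih₁ ih₂ =>
    intro B _ h H hh hH hΓ
    rw [hh.and, hH.iand]
    exact Set.mem_image2_of_mem (ih₁ B h H hh hH hΓ) (ih₂ B h H hh hH hΓ)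
  | @iandE Γ a b p q φ ψ σ hpq hfresh hpa hqa hpb hqb _ _ ih₁ ih₂ =>
    intro B _ h H hh hH hΓ
    have := ih₁ B h H hh hH hΓ
    rw [hH.iand] at this
    obtain ⟨x, hx, y, hy, hxy⟩ := this
    obtain ⟨k, hk, rfl, rfl, hkh⟩ := hh.exists_update hpq x y
    rw [← hkh b hpb hqb]
    refine ih₂ B k H hk hH (Set.forall_mem_insert.mpr ⟨hx, Set.forall_mem_insert.mpr ⟨hy,
      Set.forall_mem_insert.mpr ⟨(mem_lbEq_iff hk hH _ _).mpr ?_, fun r hr => ?_⟩⟩⟩)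
    · rw [hkh a hpa hqa, hk.and]
      exact hxy.symm
    · rw [hkh _ (hfresh r hr).1 (hfresh r hr).2]
      exact hΓ r hr
  | iorI _ _ ih₁ ih₂ =>
    intro B _ h H hh hH hΓ
    rw [hh.or, hH.ior]
    exact Set.mem_image2_of_mem (ih₁ B h H hh hH hΓ) (ih₂ B h H hh hH hΓ)
  | @iorE Γ a b p q φ ψ σ hpq hfresh hpa hqa hpb hqb _ _ ih₁ ih₂ =>
    intro B _ h H hh hH hΓ
    have := ih₁ B h H hh hH hΓ
    rw [hH.ior] at this
    obtain ⟨x, hx, y, hy, hxy⟩ := this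
    obtain ⟨k, hk, rfl, rfl, hkh⟩ := hh.exists_update hpq x y
    rw [← hkh b hpb hqb]
    refine ih₂ B k H hk hH (Set.forall_mem_insert.mpr ⟨hx, Set.forall_mem_insert.mpr ⟨hy,
      Set.forall_mem_insert.mpr ⟨(mem_lbEq_iff hk hH _ _).mpr ?_, fun r hr => ?_⟩⟩⟩)
    · rw [hkh a hpa hqa, hk.or]
      exact hxy.symm
    · rw [hkh _ (hfresh r hr).1 (hfresh r hr).2]
      exact hΓ r hr
  | inotI _ ih =>
    intro B _ h H hh hH hΓ
    rw [hh.not, hH.inot]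
    exact Set.mem_image_of_mem _ (ih B h H hh hH hΓ)
  | inotE _ ih =>
    intro B _ h H hh hH hΓ
    have := ih B h H hh hH hΓ
    rw [hH.inot] at this
    obtain ⟨x, hx, hxa⟩ := this
    rw [hh.not, ← hxa]
    simpa using hx
  | taut L _ hb ih =>
    intro B _ h H hh hH hΓ
    rw [hH.itop]
    refine hh.eq_top_of_evalBool (S := {a | a ∈ L}) (fun a ha => ?_) hb
    have := ih a ha B h H hh hH hΓ
    rwa [hH.itop] at this
  | sub _ _ ih₁ ih₂ =>
    intro B _ h H hh hH hΓ
    have := (mem_lbEq_iff hh hH _ _).mp (ih₁ B h H hh hH hΓ)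
    rw [this]
    exact ih₂ B h H hh hH hΓ
end

section
/- Compactness of LT: if Δ ⊨ ψ then there exists a finite subset Δ₀ ⊆ Δ with Δ₀ ⊨ ψ. -/
open Filter

section FilterProduct

variable {ι : Type*} {B : ι → Type*} [∀ i, BooleanAlgebra (B i)]

/-- The reduced product of a family of Boolean algebras is a Boolean algebra. -/
instance Filter.Product.instBooleanAlgebra (l : Filter ι) : BooleanAlgebra (l.Product B) where
  le := Quotient.lift₂ (fun x y => ∀ᶠ i in l, x i ≤ y i) fun _ _ _ _ hx hy =>
    propext <| eventually_congr <| by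
      filter_upwards [hx, hy] with i hx hy
      rw [hx, hy]
  sup := Quotient.map₂ (fun x y i => x i ⊔ y i) fun _ _ hx _ _ hy => by
    filter_upwards [hx, hy] with i hx hy
    rw [hx, hy]
  inf := Quotient.map₂ (fun x y i => x i ⊓ y i) fun _ _ hx _ _ hy => by
    filter_upwards [hx, hy] with i hx hy
    rw [hx, hy]
  compl := Quotient.map (fun x i => (x i)ᶜ) fun _ _ hx => by
    filter_upwards [hx] with i hx
    rw [hx]
  top := Quotient.mk _ fun _ => ⊤
  bot := Quotient.mk _ fun _ => ⊥
  le_refl := by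
    rintro ⟨x⟩
    exact Eventually.of_forall fun _ => le_rfl
  le_trans := by
    rintro ⟨x⟩ ⟨y⟩ ⟨z⟩ hxy hyz
    exact Eventually.mp hxy (Eventually.mono hyz fun _ hyz hxy => hxy.trans hyz)
  le_antisymm := by
    rintro ⟨x⟩ ⟨y⟩ hxy hyx
    exact Quotient.sound
      (Eventually.mp hxy (Eventually.mono hyx fun _ hyx hxy => hxy.antisymm hyx))
  le_sup_left := by
    rintro ⟨x⟩ ⟨y⟩
    exact Eventually.of_forall fun _ => le_sup_left
  le_sup_right := by
    rintro ⟨x⟩ ⟨y⟩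
    exact Eventually.of_forall fun _ => le_sup_right
  sup_le := by
    rintro ⟨x⟩ ⟨y⟩ ⟨z⟩ hxz hyz
    exact Eventually.mp hxz (Eventually.mono hyz fun _ hyz hxz => sup_le hxz hyz)
  inf_le_left := by
    rintro ⟨x⟩ ⟨y⟩
    exact Eventually.of_forall fun _ => inf_le_left
  inf_le_right := by
    rintro ⟨x⟩ ⟨y⟩
    exact Eventually.of_forall fun _ => inf_le_right
  le_inf := by
    rintro ⟨x⟩ ⟨y⟩ ⟨z⟩ hxy hxz
    exact Eventually.mp hxy (Eventually.mono hxz fun _ hxz hxy => le_inf hxy hxz)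
  le_sup_inf := by
    rintro ⟨x⟩ ⟨y⟩ ⟨z⟩
    exact Eventually.of_forall fun _ => le_sup_inf
  le_top := by
    rintro ⟨x⟩
    exact Eventually.of_forall fun _ => le_top
  bot_le := by
    rintro ⟨x⟩
    exact Eventually.of_forall fun _ => bot_le
  inf_compl_le_bot := by
    rintro ⟨x⟩
    exact Eventually.of_forall fun _ => inf_compl_eq_bot.le
  top_le_sup_compl := by
    rintro ⟨x⟩
    exact Eventually.of_forall fun _ => sup_compl_eq_top.ge

end FilterProduct

/-- The reduced product of a family of subsets. -/
def Filter.Product.set {ι : Type*} {B : ι → Type*} (l : Filter ι) (S : ∀ i, Set (B i)) :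
    Set (l.Product B) :=
  Quotient.lift (fun x => ∀ᶠ i in l, x i ∈ S i) fun _ _ hx =>
    propext <| eventually_congr <| by
      filter_upwards [hx] with i hx
      rw [hx]

/-- The Łoś theorem for LT: an ultraproduct of homomorphisms is a homomorphism. -/
theorem IsHom.ultraproduct {ι : Type} {B : ι → Type} [∀ i, BooleanAlgebra (B i)]
    (u : Ultrafilter ι) {H : ∀ i, Fm → Set (B i)} (hH : ∀ i, IsHom (H i)) :
    IsHom fun φ => Filter.Product.set (u : Filter ι) fun i => H i φ where
  ebot := by
    refine Set.eq_empty_of_forall_notMem ?_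
    rintro ⟨x⟩ (hx : ∀ᶠ i in u, x i ∈ H i .ebot)
    obtain ⟨i, hi⟩ := hx.exists
    rw [(hH i).ebot] at hi
    exact hi
  enot φ := by
    ext ⟨x⟩
    change (∀ᶠ i in u, x i ∈ H i (.enot φ)) ↔ ¬ ∀ᶠ i in u, x i ∈ H i φ
    simp only [(hH _).enot, Set.mem_compl_iff, Ultrafilter.eventually_not]
  eor φ ψ := by
    ext ⟨x⟩
    change (∀ᶠ i in u, x i ∈ H i (.eor φ ψ)) ↔
      (∀ᶠ i in u, x i ∈ H i φ) ∨ ∀ᶠ i in u, x i ∈ H i ψ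
    simp only [(hH _).eor, Set.mem_union, Ultrafilter.eventually_or]
  eand φ ψ := by
    ext ⟨x⟩
    change (∀ᶠ i in u, x i ∈ H i (.eand φ ψ)) ↔
      (∀ᶠ i in u, x i ∈ H i φ) ∧ ∀ᶠ i in u, x i ∈ H i ψ
    simp only [(hH _).eand, Set.mem_inter_iff, eventually_and]
  ibot := by
    ext ⟨x⟩
    change (∀ᶠ i in u, x i ∈ H i .ibot) ↔ Quotient.mk _ x = Quotient.mk _ fun _ => ⊥
    rw [Quotient.eq]
    simp only [(hH _).ibot, Set.mem_singleton_iff]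
    rfl
  inot φ := by
    ext ⟨x⟩
    change (∀ᶠ i in u, x i ∈ H i (.inot φ)) ↔ _
    simp only [(hH _).inot, Set.mem_image]
    constructor
    · intro hx
      obtain ⟨y, hy⟩ := Filter.skolem.1 hx
      exact ⟨Quotient.mk _ y, hy.mono fun _ h => h.1, Quotient.sound (hy.mono fun _ h => h.2)⟩
    · rintro ⟨⟨y⟩, hy, hyx⟩
      filter_upwards [hy, Quotient.exact hyx] with i hy hyx using ⟨y i, hy, hyx⟩
  ior φ ψ := by
    ext ⟨x⟩
    change (∀ᶠ i in u, x i ∈ H i (.ior φ ψ)) ↔ _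
    simp only [(hH _).ior, Set.mem_image2]
    constructor
    · intro hx
      obtain ⟨y, hx⟩ := Filter.skolem.1 hx
      simp only [← exists_and_left] at hx
      obtain ⟨z, hx⟩ := Filter.skolem.1 hx
      exact ⟨Quotient.mk _ y, hx.mono fun _ h => h.1, Quotient.mk _ z,
        hx.mono fun _ h => h.2.1, Quotient.sound (hx.mono fun _ h => h.2.2)⟩
    · rintro ⟨⟨y⟩, hy, ⟨z⟩, hz, hyz⟩
      filter_upwards [hy, hz, Quotient.exact hyz] with i hy hz hyz using ⟨y i, hy, z i, hz, hyz⟩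
  iand φ ψ := by
    ext ⟨x⟩
    change (∀ᶠ i in u, x i ∈ H i (.iand φ ψ)) ↔ _
    simp only [(hH _).iand, Set.mem_image2]
    constructor
    · intro hx
      obtain ⟨y, hx⟩ := Filter.skolem.1 hx
      simp only [← exists_and_left] at hx
      obtain ⟨z, hx⟩ := Filter.skolem.1 hx
      exact ⟨Quotient.mk _ y, hx.mono fun _ h => h.1, Quotient.mk _ z,
        hx.mono fun _ h => h.2.1, Quotient.sound (hx.mono fun _ h => h.2.2)⟩
    · rintro ⟨⟨y⟩, hy, ⟨z⟩, hz, hyz⟩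
      filter_upwards [hy, hz, Quotient.exact hyz] with i hy hz hyz using ⟨y i, hy, z i, hz, hyz⟩

/-- Compactness of LT. -/
theorem LT_compactness (Δ : Set Fm) (ψ : Fm) (h : Entails Δ ψ) :
    ∃ Δ₀ : Finset Fm, ↑Δ₀ ⊆ Δ ∧ Entails ↑Δ₀ ψ := by
  classical
  by_contra! hne
  have hcounter (s : Finset Δ) : ∃ (B : Type) (_ : BooleanAlgebra B) (H : Fm → Set B) (b : B),
      IsHom H ∧ (∀ φ ∈ s, b ∈ H φ) ∧ b ∉ H ψ := by
    have hs := hne (s.image (↑)) (by simp)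
    simp only [Entails, not_forall, Set.not_subset] at hs
    obtain ⟨B, _, H, hH, b, hb, hbψ⟩ := hs
    refine ⟨B, _, H, b, hH, fun φ hφ => ?_, hbψ⟩
    exact Set.mem_iInter₂.1 hb φ (Finset.mem_coe.2 (Finset.mem_image_of_mem _ hφ))
  choose B inst H b hH hb hbψ using hcounter
  let u : Ultrafilter (Finset Δ) := Ultrafilter.of atTop
  have hmem : ∀ᶠ s in (u : Filter (Finset Δ)), b s ∈ H s ψ := by
    refine h _ _ (IsHom.ultraproduct u hH) (a := Quotient.mk _ b)
      (Set.mem_iInter₂.2 fun φ hφ => ?_)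
    have hev : ∀ᶠ s : Finset Δ in atTop, b s ∈ H s φ := by
      filter_upwards [eventually_ge_atTop {⟨φ, hφ⟩}] with s hs
      exact hb s ⟨φ, hφ⟩ (hs (Finset.mem_singleton_self _))
    exact Ultrafilter.of_le atTop hev
  obtain ⟨s, hs⟩ := hmem.exists
  exact hbψ s hs
end

section
/- The class of at most countable Boolean algebras is adequate for LT: for every set Δ of LT formulas and every LT formula ψ, Δ ⊨ ψ if and only if for every Boolean algebra B whose carrier is an at most countable type and every homomorphism H : Fm → 𝒫B, ⋂_{φ∈Δ} H(φ) ⊆ H(ψ). -/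
/-- An injective coding of formulas by natural numbers. -/
def Fm.code : Fm → ℕ
  | .var i => Nat.pair 0 i
  | .ebot => Nat.pair 1 0
  | .enot φ => Nat.pair 2 φ.code
  | .eor φ ψ => Nat.pair 3 (Nat.pair φ.code ψ.code)
  | .eand φ ψ => Nat.pair 4 (Nat.pair φ.code ψ.code)
  | .ibot => Nat.pair 5 0
  | .inot φ => Nat.pair 6 φ.code
  | .ior φ ψ => Nat.pair 7 (Nat.pair φ.code ψ.code)
  | .iand φ ψ => Nat.pair 8 (Nat.pair φ.code ψ.code)

theorem Fm.code_injective : Function.Injective Fm.code := by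
  intro φ
  induction φ with
  | var _ | ebot | ibot => intro ψ h; cases ψ <;> simp_all [Fm.code]
  | enot _ ih | inot _ ih =>
    intro ψ h
    cases ψ <;> simp only [Fm.code, Nat.pair_eq_pair] at h <;> first | omega | rw [ih h.2]
  | eor _ _ ih₁ ih₂ | eand _ _ ih₁ ih₂ | ior _ _ ih₁ ih₂ | iand _ _ ih₁ ih₂ =>
    intro ψ h
    cases ψ <;> simp only [Fm.code, Nat.pair_eq_pair] at h <;>
      first | omega | rw [ih₁ h.2.1, ih₂ h.2.2]

instance Fm.instCountable : Countable Fm := Fm.code_injective.countable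

/-- A countable set extends to a countable set closed under countably many binary operations. -/
theorem Set.Countable.exists_superset_closed {α : Type*} {F : Set (α → α → α)}
    (hF : F.Countable) {s : Set α} (hs : s.Countable) :
    ∃ t, s ⊆ t ∧ t.Countable ∧ ∀ f ∈ F, ∀ x ∈ t, ∀ y ∈ t, f x y ∈ t := by
  let step : Set α → Set α := fun u => u ∪ ⋃ f ∈ F, Set.image2 f u u
  have hmono : Monotone fun n => step^[n] s :=
    monotone_nat_of_le_succ fun n => by
      rw [Function.iterate_succ_apply']
      exact Set.subset_union_left
  refine ⟨⋃ n, step^[n] s, Set.subset_iUnion (fun n => step^[n] s) 0,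
    Set.countable_iUnion fun n => ?_, ?_⟩
  · induction n with
    | zero => exact hs
    | succ n ih =>
      rw [Function.iterate_succ_apply']
      exact ih.union (hF.biUnion fun f _ => ih.image2 ih f)
  · intro f hf x hx y hy
    obtain ⟨m, hm⟩ := Set.mem_iUnion.1 hx
    obtain ⟨n, hn⟩ := Set.mem_iUnion.1 hy
    refine Set.mem_iUnion.2 ⟨max m n + 1, ?_⟩
    rw [Function.iterate_succ_apply']
    exact Or.inr (Set.mem_biUnion hf
      (Set.mem_image2_of_mem (hmono (le_max_left m n) hm) (hmono (le_max_right m n) hn)))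

/-- Decompositions of the elements of an `image2` can be chosen uniformly. -/
theorem Set.exists_image2_section {α β γ : Type*} [Nonempty α] [Nonempty β]
    (g : α → β → γ) (s : Set α) (t : Set β) :
    ∃ (l : γ → α) (r : γ → β), ∀ c ∈ Set.image2 g s t, l c ∈ s ∧ r c ∈ t ∧ g (l c) (r c) = c := by
  classical
  have h : ∀ c, ∃ (a : α) (b : β), c ∈ Set.image2 g s t → a ∈ s ∧ b ∈ t ∧ g a b = c := by
    intro c
    by_cases hc : c ∈ Set.image2 g s t
    · obtain ⟨a, ha, b, hb, rfl⟩ := hc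
      exact ⟨a, b, fun _ => ⟨ha, hb, rfl⟩⟩
    · exact ⟨Classical.arbitrary α, Classical.arbitrary β, fun h => absurd h hc⟩
  choose l r hlr using h
  exact ⟨l, r, hlr⟩

/-- Every element of a Boolean algebra lies in a countable subalgebra to which a given
homomorphism restricts. -/
theorem IsHom.exists_countable_restrict {B : Type} [BooleanAlgebra B] {H : Fm → Set B}
    (hH : IsHom H) (x : B) :
    ∃ L : BooleanSubalgebra B, Countable L ∧ x ∈ L ∧
      IsHom fun φ => ((↑) : L → B) ⁻¹' H φ := by
  have hsup := fun p : Fm × Fm => Set.exists_image2_section (· ⊔ ·) (H p.1) (H p.2)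
  have hinf := fun p : Fm × Fm => Set.exists_image2_section (· ⊓ ·) (H p.1) (H p.2)
  choose l r hlr using hsup
  choose l' r' hlr' using hinf
  let F : Set (B → B → B) :=
    {(· ⊔ ·), (· ⊓ ·), fun a _ => aᶜ} ∪
      ((Set.range fun p a _ => l p a) ∪ (Set.range fun p a _ => r p a) ∪
        (Set.range fun p a _ => l' p a) ∪ (Set.range fun p a _ => r' p a))
  have hF : F.Countable :=
    (Set.toFinite _).countable.union
      ((((Set.countable_range _).union (Set.countable_range _)).union
        (Set.countable_range _)).union (Set.countable_range _))
  obtain ⟨t, hst, ht, hcl⟩ :=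
    hF.exists_superset_closed (s := {⊥, x}) (Set.toFinite _).countable
  have hl : ∀ p, ∀ a ∈ t, l p a ∈ t := fun p a ha =>
    hcl (fun a _ => l p a) (by simp [F]) a ha a ha
  have hr : ∀ p, ∀ a ∈ t, r p a ∈ t := fun p a ha =>
    hcl (fun a _ => r p a) (by simp [F]) a ha a ha
  have hl' : ∀ p, ∀ a ∈ t, l' p a ∈ t := fun p a ha =>
    hcl (fun a _ => l' p a) (by simp [F]) a ha a ha
  have hr' : ∀ p, ∀ a ∈ t, r' p a ∈ t := fun p a ha =>
    hcl (fun a _ => r' p a) (by simp [F]) a ha a ha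
  let L : BooleanSubalgebra B :=
    { carrier := t
      bot_mem' := hst (by simp)
      compl_mem' := fun {a} ha => hcl (fun a _ => aᶜ) (by simp [F]) a ha a ha
      supClosed' := fun a ha b hb => hcl (· ⊔ ·) (by simp [F]) a ha b hb
      infClosed' := fun a ha b hb => hcl (· ⊓ ·) (by simp [F]) a ha b hb }
  refine ⟨L, ht.to_subtype, hst (by simp), ?_⟩
  constructor
  · simp [hH.ebot]
  · simp [hH.enot]
  · simp [hH.eor]
  · simp [hH.eand]
  · ext a
    simp only [hH.ibot, Set.mem_preimage, Set.mem_singleton_iff]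
    exact ⟨fun h => Subtype.ext h, fun h => congrArg Subtype.val h⟩
  · intro φ
    ext a
    simp only [hH.inot, Set.mem_preimage, Set.mem_image]
    constructor
    · rintro ⟨b, hb, hba⟩
      refine ⟨aᶜ, ?_, compl_compl a⟩
      rwa [BooleanSubalgebra.val_compl, ← hba, compl_compl]
    · rintro ⟨b, hb, rfl⟩
      exact ⟨b, hb, rfl⟩
  · intro φ ψ
    ext a
    simp only [hH.ior, Set.mem_preimage]
    constructor
    · intro ha
      obtain ⟨h₁, h₂, h₃⟩ := hlr (φ, ψ) a ha
      exact ⟨⟨_, hl (φ, ψ) a a.2⟩, h₁, ⟨_, hr (φ, ψ) a a.2⟩, h₂, Subtype.ext h₃⟩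
    · rintro ⟨b, hb, c, hc, rfl⟩
      exact ⟨b, hb, c, hc, rfl⟩
  · intro φ ψ
    ext a
    simp only [hH.iand, Set.mem_preimage]
    constructor
    · intro ha
      obtain ⟨h₁, h₂, h₃⟩ := hlr' (φ, ψ) a ha
      exact ⟨⟨_, hl' (φ, ψ) a a.2⟩, h₁, ⟨_, hr' (φ, ψ) a a.2⟩, h₂, Subtype.ext h₃⟩
    · rintro ⟨b, hb, c, hc, rfl⟩
      exact ⟨b, hb, c, hc, rfl⟩

/-- The class of at most countable Boolean algebras is adequate for LT. -/
theorem countable_adequate (Δ : Set Fm) (ψ : Fm) :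
    Entails Δ ψ ↔
      ∀ (B : Type) [BooleanAlgebra B] [Countable B] (H : Fm → Set B),
        IsHom H → (⋂ φ ∈ Δ, H φ) ⊆ H ψ := by
  refine ⟨fun h B _ _ H hH => h B H hH, fun h B _ H hH x hx => ?_⟩
  obtain ⟨L, _, hxL, hK⟩ := hH.exists_countable_restrict x
  refine h L _ hK (show (⟨x, hxL⟩ : L) ∈ _ from ?_)
  simpa using hx
end

section
/- For every Boolean algebra B, every homomorphism H : Fm → 𝒫B, and every LT formula φ: H(∼φ) = ∼H(φ), i.e. the interpretation of the defined strict-negation connective equals the strict negation of the interpretation. -/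
/-- The defined strict negation is interpreted as the strict negation of the
interpretation. -/
theorem snot_eval (B : Type) [BooleanAlgebra B] (H : Fm → Set B)
    (hH : IsHom H) (φ : Fm) : H (Fm.snot φ) = sNeg (H φ) := by
  have mem_meets (b : B) :
      b ∈ H (.ior (.eand (.iand φ (.enot .ebot)) (.enot .ibot)) (.enot .ebot)) ↔
        ∃ a ∈ H φ, b ⊓ a ≠ ⊥ := by
    rw [hH.ior, hH.eand, hH.iand, hH.enot .ibot, hH.enot .ebot, hH.ebot, hH.ibot]
    constructor
    · rintro ⟨_, ⟨⟨a, ha, c, -, rfl⟩, hne⟩, d, -, rfl⟩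
      refine ⟨a, ha, fun h => hne ?_⟩
      exact le_bot_iff.mp ((le_inf le_sup_left inf_le_left).trans h.le)
    · rintro ⟨a, ha, hne⟩
      refine ⟨a ⊓ b, ⟨⟨a, ha, b, Set.notMem_empty b, rfl⟩, ?_⟩, b, Set.notMem_empty b,
        sup_eq_right.mpr inf_le_right⟩
      rwa [inf_comm] at hne
  ext b
  rw [Fm.snot, hH.enot, Set.mem_compl_iff, mem_meets]
  simp only [sNeg, Set.mem_ofPred_eq, not_exists, not_and, ne_eq, not_not]
end

section
/- Failures of strict-negation laws in LT: (i) not ⊨ ¬∼∼P ∨ P, i.e. there exist a Boolean algebra B and a homomorphism H : Fm → 𝒫B with H(¬∼∼P ∨ P) ≠ B (equivalently H(∼∼P) ⊄ H(P)), where P is a propositional variable; (ii) not ⊨ P i∨ ∼P, i.e. there exist B and H with H(P i∨ ∼P) ≠ B; (iii) not ⊨ ∼P i∨ ∼∼P, i.e. there exist B and H with H(∼P i∨ ∼∼P) ≠ B. -/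
theorem Fm.isHom_eval {B : Type} [BooleanAlgebra B] (v : ℕ → Set B) : IsHom (Fm.eval v) where
  ebot := rfl
  enot _ := rfl
  eor _ _ := rfl
  eand _ _ := rfl
  ibot := rfl
  inot _ := rfl
  ior _ _ := rfl
  iand _ _ := rfl

theorem IsHom.snot {B : Type} [BooleanAlgebra B] {H : Fm → Set B} (hH : IsHom H) (φ : Fm) :
    H φ.snot = sNeg (H φ) := by
  ext b
  simp only [Fm.snot, hH.enot, hH.ior, hH.eand, hH.iand, hH.ebot, hH.ibot, sNeg,
    Set.compl_empty, Set.mem_compl_iff, Set.mem_image2, Set.mem_inter_iff, Set.mem_univ,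
    Set.mem_singleton_iff, Set.mem_ofPred_eq, true_and]
  constructor
  · intro h a ha
    by_contra hne
    exact h ⟨b ⊓ a, ⟨⟨a, ha, b, inf_comm a b⟩, hne⟩, b, sup_of_le_right inf_le_left⟩
  · rintro h ⟨_, ⟨⟨a, ha, c, rfl⟩, hne⟩, d, rfl⟩
    refine hne (le_bot_iff.mp ?_)
    rw [← h a ha]
    exact le_inf le_sup_left inf_le_left

@[simp] theorem sNeg_empty {B : Type} [BooleanAlgebra B] : sNeg (∅ : Set B) = Set.univ := by
  simp [sNeg]

@[simp] theorem sNeg_univ {B : Type} [BooleanAlgebra B] : sNeg (Set.univ : Set B) = {⊥} := by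
  ext b
  refine ⟨fun h => ?_, fun h a _ => ?_⟩
  · simpa using h ⊤ (Set.mem_univ _)
  · rw [Set.mem_singleton_iff.mp h, bot_inf_eq]

/-- The Boolean algebra of finite and cofinite subsets of `α`. -/
def finiteCofinite (α : Type) : BooleanSubalgebra (Set α) where
  carrier := {s | s.Finite ∨ sᶜ.Finite}
  supClosed' := by
    rintro s (hs | hs) t (ht | ht)
    · exact Or.inl (hs.union ht)
    all_goals
      right
      rw [compl_sup]
    · exact ht.inter_of_right _
    · exact hs.inter_of_left _
    · exact hs.inter_of_left _
  infClosed' := by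
    rintro s (hs | hs) t (ht | ht)
    · exact Or.inl (hs.inter_of_left _)
    · exact Or.inl (hs.inter_of_left _)
    · exact Or.inl (ht.inter_of_right _)
    · right
      rw [compl_inf]
      exact hs.union ht
  compl_mem' := by
    rintro s (hs | hs)
    · exact Or.inr (by rwa [compl_compl])
    · exact Or.inl hs
  bot_mem' := Or.inl Set.finite_empty

/-- A singleton as an element of the finite-cofinite algebra. -/
def finiteCofinite.singleton {α : Type} (a : α) : finiteCofinite α :=
  ⟨{a}, Or.inl (Set.finite_singleton a)⟩

theorem finiteCofinite.inf_singleton_eq_bot {α : Type} {x : finiteCofinite α} {a : α} :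
    x ⊓ singleton a = ⊥ ↔ a ∉ (x : Set α) := by
  rw [← Subtype.coe_inj]
  exact Set.inter_singleton_eq_empty

/-- An element of the finite-cofinite algebra that misses infinitely many points is finite. -/
theorem finiteCofinite.finite_of_disjoint {α : Type} (x : finiteCofinite α) {s : Set α}
    (hs : s.Infinite) (h : ∀ a ∈ s, a ∉ (x : Set α)) : (x : Set α).Finite :=
  x.2.resolve_right fun hx => hs (hx.subset h)

/-- For an infinite, coinfinite `s`, the family of singletons of points of `s` violates the
internal weak excluded middle. -/
theorem finiteCofinite.image2_sup_sNeg_ne_univ {α : Type} {s : Set α} (hs : s.Infinite)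
    (hs' : sᶜ.Infinite) :
    Set.image2 (· ⊔ ·) (sNeg (singleton '' s)) (sNeg (sNeg (singleton '' s))) ≠ Set.univ := by
  intro h
  obtain ⟨x, hx, y, hy, hxy⟩ := h.symm ▸ Set.mem_univ (⊤ : finiteCofinite α)
  have hxfin := finite_of_disjoint x hs fun a ha =>
    inf_singleton_eq_bot.mp (hx _ (Set.mem_image_of_mem _ ha))
  have hyfin := finite_of_disjoint y hs' fun a ha => by
    refine inf_singleton_eq_bot.mp (hy _ ?_)
    rintro _ ⟨b, hb, rfl⟩
    exact inf_singleton_eq_bot.mpr fun hba => ha (Set.mem_singleton_iff.mp hba ▸ hb)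
  have huniv : (x : Set α) ∪ y = Set.univ := congrArg Subtype.val hxy
  exact hs ((hxfin.union hyfin).subset (huniv ▸ Set.subset_univ s))

/-- Failures of strict-negation laws in LT. -/
theorem snot_failures :
    (∃ (B : Type) (inst : BooleanAlgebra B) (H : Fm → Set B),
      @IsHom B inst H ∧
      H (Fm.eor (Fm.enot (Fm.snot (Fm.snot (Fm.var 0)))) (Fm.var 0)) ≠
        Set.univ) ∧
    (∃ (B : Type) (inst : BooleanAlgebra B) (H : Fm → Set B),
      @IsHom B inst H ∧
      H (Fm.ior (Fm.var 0) (Fm.snot (Fm.var 0))) ≠ Set.univ) ∧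
    (∃ (B : Type) (inst : BooleanAlgebra B) (H : Fm → Set B),
      @IsHom B inst H ∧
      H (Fm.ior (Fm.snot (Fm.var 0)) (Fm.snot (Fm.snot (Fm.var 0)))) ≠
        Set.univ) := by
  refine ⟨⟨Bool, inferInstance, Fm.eval fun _ => ∅, Fm.isHom_eval _, ?_⟩,
    ⟨Bool, inferInstance, Fm.eval fun _ => ∅, Fm.isHom_eval _, ?_⟩,
    ⟨finiteCofinite ℕ, inferInstance,
      Fm.eval fun _ => finiteCofinite.singleton '' {n | Even n}, Fm.isHom_eval _, ?_⟩⟩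
  · rw [(Fm.isHom_eval _).eor, (Fm.isHom_eval _).enot, (Fm.isHom_eval _).snot,
      (Fm.isHom_eval _).snot]
    simp [Fm.eval, -Bool.univ_eq]
  · rw [(Fm.isHom_eval _).ior]
    simpa [Fm.eval, -Bool.univ_eq] using Set.empty_ne_univ
  · rw [(Fm.isHom_eval _).ior, (Fm.isHom_eval _).snot (.snot _), (Fm.isHom_eval _).snot]
    refine finiteCofinite.image2_sup_sNeg_ne_univ
      (Set.infinite_of_injective_forall_mem (f := fun n => 2 * n) ?_ ?_)
      (Set.infinite_of_injective_forall_mem (f := fun n => 2 * n + 1) ?_ ?_)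
    · intro m n h
      simpa using h
    · intro n
      simp
    · intro m n h
      simpa using h
    · intro n
      simp
end

section
/- Suppose the class 𝓗 of homomorphisms is definable by the set Π of LT formulas, and let □Π = {□π : π ∈ Π}. Then for every set Δ of LT formulas and every LT formula φ: □Π ∪ Δ ⊨ φ (in LT) if and only if 𝓗 : Δ ⊨ φ. -/
namespace IsHom

variable {B : Type} [BooleanAlgebra B] {H : Fm → Set B}

theorem mem_diam_iff (hH : IsHom H) {φ : Fm} {b : B} : b ∈ H φ.diam ↔ (H φ).Nonempty := by
  simp only [Fm.diam, hH.ior, hH.iand, hH.enot, hH.ebot, Set.compl_empty]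
  constructor
  · rintro ⟨_, ⟨a, ha, _⟩, _⟩
    exact ⟨a, ha⟩
  · rintro ⟨a, ha⟩
    exact ⟨⊥, ⟨a, ha, ⊥, trivial, inf_bot_eq a⟩, b, trivial, bot_sup_eq b⟩

theorem mem_box_iff (hH : IsHom H) {φ : Fm} {b : B} : b ∈ H φ.box ↔ H φ = Set.univ := by
  rw [Fm.box, hH.enot, Set.mem_compl_iff, hH.mem_diam_iff, hH.enot, Set.not_nonempty_iff_eq_empty,
    Set.compl_empty_iff]

end IsHom

/-- Axiomatisation of the logic of a definable class of homomorphisms. -/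
theorem definable_class_axiomatisation (C : Set LTHom) (Ax : Set Fm)
    (hdef : DefinableBy C Ax) (Δ : Set Fm) (φ : Fm) :
    Entails ((Fm.box '' Ax) ∪ Δ) φ ↔ ClassEntails C Δ φ := by
  constructor
  · intro hent h hC b hb
    let := h.inst
    refine hent h.carrier h.H h.isHom (Set.mem_iInter₂.2 ?_)
    rintro _ (⟨π, hπ, rfl⟩ | hψ)
    · exact h.isHom.mem_box_iff.2 ((hdef h).1 hC π hπ)
    · exact Set.mem_iInter₂.1 hb _ hψ
  · intro hent B _ H hH b hb
    rw [Set.mem_iInter₂] at hb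
    refine hent ⟨B, _, H, hH⟩ ((hdef _).2 fun π hπ => ?_)
      (Set.mem_iInter₂.2 fun ψ hψ => hb ψ (Or.inr hψ))
    exact hH.mem_box_iff.1 (hb π.box (Or.inl ⟨π, hπ, rfl⟩))
end

section
/- For all LT formulas φ, ψ: □φ ⊨ ψ if and only if for every Boolean algebra B and every homomorphism H : Fm → 𝒫B, H(φ) = B implies H(ψ) = B. -/
theorem IsHom.mem_diam_iff_s13 {B : Type} [BooleanAlgebra B] {H : Fm → Set B} (hH : IsHom H)
    {φ : Fm} {b : B} : b ∈ H (Fm.diam φ) ↔ (H φ).Nonempty := by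
  simp only [Fm.diam, hH.ior, hH.iand, hH.enot, hH.ebot, Set.compl_empty]
  constructor
  · rintro ⟨_, ⟨a, ha, _⟩, _⟩
    exact ⟨a, ha⟩
  · rintro ⟨a, ha⟩
    exact ⟨a ⊓ ⊥, ⟨a, ha, ⊥, Set.mem_univ _, rfl⟩, b, Set.mem_univ _, by simp⟩

theorem IsHom.mem_box_iff_s13 {B : Type} [BooleanAlgebra B] {H : Fm → Set B} (hH : IsHom H)
    {φ : Fm} {b : B} : b ∈ H (Fm.box φ) ↔ H φ = Set.univ := by
  rw [Fm.box, hH.enot, Set.mem_compl_iff, hH.mem_diam_iff_s13, hH.enot, Set.nonempty_compl,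
    not_not]

/-- `□φ ⊨ ψ` iff truth (the designated value `B`) is preserved. -/
theorem box_entails_iff (φ ψ : Fm) :
    Entails {Fm.box φ} ψ ↔
      ∀ (B : Type) [BooleanAlgebra B] (H : Fm → Set B), IsHom H →
        (H φ = Set.univ → H ψ = Set.univ) := by
  simp only [Entails, Set.mem_singleton_iff, Set.iInter_iInter_eq_left]
  constructor
  · intro h B _ H hH hφ
    exact Set.eq_univ_of_forall fun b => h B H hH (hH.mem_box_iff_s13.2 hφ)
  · intro h B _ H hH b hb
    exact h B H hH (hH.mem_box_iff_s13.1 hb) ▸ Set.mem_univ b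
end

section
/- Excluded middle characterises principal ideals: for every Boolean algebra B, every homomorphism H : Fm → 𝒫B, and every LT formula φ, H(φ i∨ ∼φ) = B if and only if H(φ) is a principal ideal of B, i.e. there exists a ∈ B with H(φ) = {b ∈ B : b ≤ a}. -/
/-- Every element is a join of a member of `A` and a member of its strict negation exactly when
`A` is a principal ideal. -/
theorem image2_sup_sNeg_eq_univ_iff {B : Type} [BooleanAlgebra B] (A : Set B) :
    Set.image2 (· ⊔ ·) A (sNeg A) = Set.univ ↔ ∃ a : B, A = {b | b ≤ a} := by
  constructor
  · intro h
    rw [Set.eq_univ_iff_forall] at h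
    obtain ⟨a, ha, n, hn, han : a ⊔ n = ⊤⟩ := h ⊤
    refine ⟨a, Set.ext fun c => ⟨fun hc => ?_, fun hc => ?_⟩⟩
    · have hd : Disjoint c n := disjoint_iff.2 ((inf_comm c n).trans (hn c hc))
      exact hd.left_le_of_le_sup_right (han.symm ▸ le_top)
    · obtain ⟨x, hx, m, hm, rfl⟩ := h c
      have hma : m ≤ a := le_sup_right.trans hc
      have hm0 : m = ⊥ := by rw [← hm a ha, inf_eq_left.2 hma]
      simpa [hm0] using hx
  · rintro ⟨a, rfl⟩
    refine Set.eq_univ_of_forall fun b => ⟨b ⊓ a, inf_le_right, b ⊓ aᶜ, fun c hc => ?_, ?_⟩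
    · exact (disjoint_compl_left.mono inf_le_right hc).eq_bot
    · simp [← inf_sup_left]

/-- Excluded middle for strict negation characterises principal ideals. -/
theorem excluded_middle_principal (B : Type) [BooleanAlgebra B]
    (H : Fm → Set B) (hH : IsHom H) (φ : Fm) :
    H (Fm.ior φ (Fm.snot φ)) = Set.univ ↔
      ∃ a : B, H φ = {b | b ≤ a} := by
  rw [hH.ior, hH.snot, image2_sup_sNeg_eq_univ_iff]
end

section
/- For every set Δ ∪ {φ} of PT⁺ formulas: PT⁺: Δ ⊨ φ if and only if ⋂_{δ∈Δ} H_V(δ) ⊆ H_V(φ). Consequently, if Δ ⊨ φ in LT then PT⁺: Δ ⊨ φ. -/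
theorem IsHom.mem_snot {B : Type} [BooleanAlgebra B] {H : Fm → Set B} (hH : IsHom H)
    {φ : Fm} {b : B} : b ∈ H φ.snot ↔ b ∈ sNeg (H φ) := by
  simp only [Fm.snot, hH.enot, hH.ior, hH.eand, hH.iand, hH.ebot, hH.ibot, sNeg,
    Set.compl_empty, Set.mem_compl_iff, Set.mem_image2, Set.mem_inter_iff, Set.mem_univ,
    true_and, Set.mem_singleton_iff, Set.mem_ofPred_eq]
  constructor
  · intro h a ha
    by_contra hne
    exact h ⟨b ⊓ a, ⟨⟨a, ha, b, inf_comm a b⟩, hne⟩, b, by simp⟩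
  · rintro h ⟨_, ⟨⟨a, ha, c, rfl⟩, hne⟩, d, rfl⟩
    refine hne (eq_bot_iff.2 ?_)
    rw [← h a ha]
    exact le_inf le_sup_left inf_le_left

theorem PTFm.HV_toFm (φ : PTFm) : HV φ.toFm = φ.den := by
  induction φ with
  | var i => rfl
  | snotVar i =>
    ext X
    refine (Fm.isHom_eval _).mem_snot.trans ⟨fun h s hs => ?_, fun h Y hY => ?_⟩
    · by_contra hne
      have hbot : X ∩ {s} = ∅ := h {s} fun t ht => by
        rw [Set.mem_singleton_iff.1 ht]
        simpa using hne
      exact (hbot.subset ⟨hs, rfl⟩ : s ∈ (∅ : Set (ℕ → Bool)))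
    · refine Set.eq_empty_of_forall_notMem fun s hs => ?_
      exact Bool.false_ne_true ((h s hs.1).symm.trans (hY s hs.2))
  | ibot => rfl
  | nb => rfl
  | ior φ ψ ihφ ihψ => exact congrArg₂ (Set.image2 (· ∪ ·)) ihφ ihψ
  | eand φ ψ ihφ ihψ => exact congrArg₂ (· ∩ ·) ihφ ihψ
  | eor φ ψ ihφ ihψ => exact congrArg₂ (· ∪ ·) ihφ ihψ

/-- PT⁺ entailment coincides with local entailment of the valuation
homomorphism `H_V`; hence LT entailment implies PT⁺ entailment. -/
theorem PT_valuation_model (Δ : Set PTFm) (φ : PTFm) :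
    (PTEntails Δ φ ↔ (⋂ δ ∈ Δ, HV δ.toFm) ⊆ HV φ.toFm) ∧
    (Entails (PTFm.toFm '' Δ) φ.toFm → PTEntails Δ φ) := by
  have key : PTEntails Δ φ ↔ (⋂ δ ∈ Δ, HV δ.toFm) ⊆ HV φ.toFm := by
    simp only [PTEntails, PTFm.HV_toFm]
  refine ⟨key, fun h => key.2 ?_⟩
  have hHV := h (Set (ℕ → Bool)) HV (Fm.isHom_eval _)
  rwa [Set.biInter_image] at hHV
end
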